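/- Let C : F(X,Y,Z) = 0 be a smooth projective plane curve of degree d ≥ 3 over a number field k (so of genus g ≥ 1). Then every rational arithmetic progression sequence on C is of finite length. -/

import Mathlib

open MvPolynomial

set_option synthInstance.maxHeartbeats 400000
set_option maxHeartbeats 1000000

noncomputable section

/-- `F` defines a smooth projective plane curve of degree `d` over `k`: it is homogeneous of
degree `d` and, over the algebraic closure of `k`, `F` and its partial derivatives have no
common nontrivial zero (the Jacobian criterion for smoothness of the plane curve `F = 0`). -/
def IsSmoothPlaneCurve {k : Type} [Field k] (d : ℕ) (F : MvPolynomial (Fin 3) k) : Prop :=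
  F.IsHomogeneous d ∧
    ∀ P : Fin 3 → AlgebraicClosure k, P ≠ 0 →
      ∃ i : Fin 3, eval P (map (algebraMap k (AlgebraicClosure k)) (pderiv i F)) ≠ 0

open scoped Polynomial

section PolynomialPoints

variable {k : Type} [Field k]

lemma derivative_aeval_mvPolynomial {σ : Type*} [Fintype σ] (G : MvPolynomial σ k) (v : σ → k[X]) :
    Polynomial.derivative (aeval v G) =
      ∑ i, aeval v (pderiv i G) * Polynomial.derivative (v i) := by
  classical
  induction G using MvPolynomial.induction_on with
  | C a => simp [← MvPolynomial.algebraMap_eq, Polynomial.algebraMap_eq]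
  | add p q hp hq => simp [hp, hq, add_mul, Finset.sum_add_distrib]
  | mul_X p j hp =>
    simp only [map_mul, aeval_X, Polynomial.derivative_mul, hp, Derivation.leibniz, pderiv_X,
      smul_eq_mul, map_add, add_mul, Finset.sum_add_distrib, Finset.sum_mul]
    rw [add_comm]
    refine congrArg₂ _ ?_ ?_
    · rw [Finset.sum_eq_single j]
      · simp
      · intro b _ hb
        simp [hb.symm]
      · simp
    · exact Finset.sum_congr rfl fun i _ => by ring

lemma coeff_finset_prod_of_natDegree_le {σ : Type*} (s : Finset σ) (f : σ → k[X]) (e : σ → ℕ)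
    (hf : ∀ i ∈ s, (f i).natDegree ≤ e i) :
    (∏ i ∈ s, f i).coeff (∑ i ∈ s, e i) = ∏ i ∈ s, (f i).coeff (e i) := by
  classical
  induction s using Finset.induction_on with
  | empty => simp
  | insert a s ha ih =>
    rw [Finset.prod_insert ha, Finset.sum_insert ha, Finset.prod_insert ha,
      Polynomial.coeff_mul_add_eq_of_natDegree_le (hf a (Finset.mem_insert_self a s)),
      ih fun i hi => hf i (Finset.mem_insert_of_mem hi)]
    exact (Polynomial.natDegree_prod_le _ _).trans
      (Finset.sum_le_sum fun i hi => hf i (Finset.mem_insert_of_mem hi))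

lemma natDegree_aeval_le_and_coeff {σ : Type*} [Fintype σ] {G : MvPolynomial σ k} {n : ℕ}
    (hG : G.IsHomogeneous n) (v : σ → k[X]) {δ : ℕ} (hv : ∀ i, (v i).natDegree ≤ δ) :
    (aeval v G).natDegree ≤ n * δ ∧
      (aeval v G).coeff (n * δ) = eval (fun i => (v i).coeff δ) G := by
  have hpow (m : σ →₀ ℕ) (i : σ) : (v i ^ m i).natDegree ≤ m i * δ :=
    Polynomial.natDegree_pow_le_of_le _ (hv i)
  have hsum : ∀ m ∈ G.support, ∑ i, m i * δ = n * δ := by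
    intro m hm
    have := hG (mem_support_iff.mp hm)
    rw [Finsupp.weight_apply, Finsupp.sum_fintype _ _ (by simp)] at this
    rw [← Finset.sum_mul, ← this]
    simp
  rw [aeval_def, eval₂_eq', eval_eq', Polynomial.finsetSum_coeff]
  constructor
  · refine Polynomial.natDegree_sum_le_of_forall_le _ _ fun m hm => ?_
    refine (Polynomial.natDegree_C_mul_le _ _).trans ?_
    rw [← hsum m hm]
    exact (Polynomial.natDegree_prod_le _ _).trans (Finset.sum_le_sum fun i _ => hpow m i)
  · refine Finset.sum_congr rfl fun m hm => ?_
    rw [Polynomial.algebraMap_eq, Polynomial.coeff_C_mul, ← hsum m hm,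
      coeff_finset_prod_of_natDegree_le _ _ _ fun i _ => hpow m i]
    simp_rw [Polynomial.coeff_pow_of_natDegree_le (hv _)]

lemma exists_coeff_ne_zero_of_natDegree_sup {v : Fin 3 → k[X]} (hv : v ≠ 0) :
    ∃ δ, (∀ i, (v i).natDegree ≤ δ) ∧ (fun i => (v i).coeff δ) ≠ 0 := by
  refine ⟨Finset.univ.sup fun i => (v i).natDegree,
    fun i => Finset.le_sup (f := fun i => (v i).natDegree) (Finset.mem_univ i), fun h => hv ?_⟩
  obtain ⟨j, -, hj⟩ := Finset.exists_mem_eq_sup Finset.univ Finset.univ_nonempty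
    fun i => (v i).natDegree
  have hj0 : v j = 0 := by
    have := congrFun h j
    simp only [hj] at this
    simpa using this
  funext i
  have hi := Finset.le_sup (f := fun i => (v i).natDegree) (Finset.mem_univ i)
  rw [hj, hj0, Polynomial.natDegree_zero, Nat.le_zero] at hi
  have hc := congrFun h i
  simp only [hj, hj0, Polynomial.natDegree_zero, Pi.zero_apply] at hc
  rw [Polynomial.eq_C_of_natDegree_eq_zero hi, hc]
  simp

lemma IsSmoothPlaneCurve.exists_eval_pderiv_ne_zero {d : ℕ} {F : MvPolynomial (Fin 3) k}
    (hF : IsSmoothPlaneCurve d F) {p : Fin 3 → k} (hp : p ≠ 0) :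
    ∃ i, eval p (pderiv i F) ≠ 0 := by
  obtain ⟨i, hi⟩ := hF.2 (fun j => algebraMap k (AlgebraicClosure k) (p j)) fun h => hp <| by
    funext j
    simpa using congrFun h j
  refine ⟨i, fun h => hi ?_⟩
  rw [eval_map, ← Function.comp_def, ← eval₂_comp, h, map_zero]

lemma IsSmoothPlaneCurve.exists_sum_mul_aeval_pderiv_eq_one {d : ℕ} {F : MvPolynomial (Fin 3) k}
    (hF : IsSmoothPlaneCurve d F) {v : Fin 3 → k[X]} {i j : Fin 3} (hv : IsCoprime (v i) (v j)) :
    ∃ a : Fin 3 → k[X], ∑ l, a l * aeval v (pderiv l F) = 1 := by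
  let I := Ideal.span (Set.range fun l => aeval v (pderiv l F))
  suffices h : I = ⊤ by
    have := (Ideal.eq_top_iff_one _).mp h
    exact Ideal.mem_span_range_iff_exists_fun.mp this
  obtain ⟨g, hg⟩ := (inferInstance : I.IsPrincipal).principal
  by_contra hI
  have hgu : g.degree ≠ 0 := fun h => hI <| by
    rw [hg]
    exact Ideal.span_singleton_eq_top.mpr (Polynomial.isUnit_iff_degree_eq_zero.mpr h)
  obtain ⟨x, hx⟩ := IsAlgClosed.exists_aeval_eq_zero (AlgebraicClosure k) g hgu
  have hroot : ∀ l, Polynomial.aeval x (aeval v (pderiv l F)) = 0 := fun l => by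
    have hmem : aeval v (pderiv l F) ∈ I := Ideal.subset_span ⟨l, rfl⟩
    rw [hg] at hmem
    obtain ⟨c, hc⟩ := Ideal.mem_span_singleton.mp hmem
    rw [hc, map_mul, hx, zero_mul]
  obtain ⟨l, hl⟩ := hF.2 (fun l => Polynomial.aeval x (v l)) fun h => by
    obtain ⟨a, b, hab⟩ := hv
    have h1 := congrArg (Polynomial.aeval x) hab
    have hi := congrFun h i
    have hj := congrFun h j
    simp only [Pi.zero_apply] at hi hj
    simp [hi, hj] at h1
  refine hl ?_
  rw [← hroot l, eval_map, ← aeval_def, ← comp_aeval_apply]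

/-- The Wronskian of two coordinates of a polynomial point on a smooth plane curve of degree at
least three vanishes: such a curve is not rational. -/
lemma IsSmoothPlaneCurve.wronskian_eq_zero [CharZero k] {d : ℕ} (hd : 3 ≤ d)
    {F : MvPolynomial (Fin 3) k} (hF : IsSmoothPlaneCurve d F) {v : Fin 3 → k[X]}
    (hv : IsCoprime (v 1) (v 2)) (h0 : aeval v F = 0) :
    v 0 * Polynomial.derivative (v 1) - v 1 * Polynomial.derivative (v 0) = 0 := by
  by_contra hw
  set D : Fin 3 → k[X] := fun i => Polynomial.derivative (v i) with hD
  set g : Fin 3 → k[X] := fun i => aeval v (pderiv i F) with hg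
  have e1 : v 0 * g 0 + v 1 * g 1 + v 2 * g 2 = 0 := by
    have := congrArg (aeval v) hF.1.sum_X_mul_pderiv
    simpa [Fin.sum_univ_three, h0] using this
  have e2 : g 0 * D 0 + g 1 * D 1 + g 2 * D 2 = 0 := by
    have := derivative_aeval_mvPolynomial F v
    rw [h0] at this
    simpa [Fin.sum_univ_three] using this.symm
  obtain ⟨a, ha⟩ := hF.exists_sum_mul_aeval_pderiv_eq_one hv
  replace ha : a 0 * g 0 + a 1 * g 1 + a 2 * g 2 = 1 := by
    simpa [Fin.sum_univ_three] using ha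
  set c0 := v 1 * D 2 - v 2 * D 1 with hc0
  set c1 := v 2 * D 0 - v 0 * D 2 with hc1
  set c2 := v 0 * D 1 - v 1 * D 0 with hc2
  have h01 : c0 * g 1 = c1 * g 0 := by
    rw [hc0, hc1]; linear_combination D 2 * e1 - v 2 * e2
  have h12 : c1 * g 2 = c2 * g 1 := by
    rw [hc1, hc2]; linear_combination D 0 * e1 - v 0 * e2
  have h20 : c2 * g 0 = c0 * g 2 := by
    rw [hc2, hc0]; linear_combination D 1 * e1 - v 1 * e2
  set lam := a 0 * c0 + a 1 * c1 + a 2 * c2 with hlam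
  have l0 : c0 = lam * g 0 := by
    rw [hlam]; linear_combination -c0 * ha + a 1 * h01 - a 2 * h20
  have l1 : c1 = lam * g 1 := by
    rw [hlam]; linear_combination -c1 * ha - a 0 * h01 + a 2 * h12
  have l2 : c2 = lam * g 2 := by
    rw [hlam]; linear_combination -c2 * ha + a 0 * h20 - a 1 * h12
  have hlam0 : lam ≠ 0 := fun h => hw <| by
    rw [l2, h, zero_mul]
  have hv0 : v ≠ 0 := fun h => hw <| by
    change v 0 * Polynomial.derivative (v 1) - v 1 * Polynomial.derivative (v 0) = 0
    simp [h]
  obtain ⟨δ, hδ, hδ0⟩ := exists_coeff_ne_zero_of_natDegree_sup hv0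
  have hδpos : δ ≠ 0 := by
    rintro rfl
    refine hw ?_
    change v 0 * Polynomial.derivative (v 1) - v 1 * Polynomial.derivative (v 0) = 0
    rw [Polynomial.derivative_of_natDegree_zero (Nat.le_zero.mp (hδ 0)),
      Polynomial.derivative_of_natDegree_zero (Nat.le_zero.mp (hδ 1))]
    simp
  have hmul : ∀ i j, (v i * D j).natDegree < 2 * δ := fun i j => by
    have h1 := Polynomial.natDegree_mul_le (p := v i) (q := D j)
    have h2 := Polynomial.natDegree_derivative_le (v j)
    have h3 := hδ i
    have h4 := hδ j
    have h5 : (D j).natDegree ≤ (v j).natDegree - 1 := h2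
    omega
  have hsub : ∀ i j, (v i * D j - v j * D i).natDegree < 2 * δ := fun i j =>
    (Polynomial.natDegree_sub_le _ _).trans_lt (max_lt (hmul i j) (hmul j i))
  obtain ⟨i, hi⟩ := hF.exists_eval_pderiv_ne_zero hδ0
  rw [← (natDegree_aeval_le_and_coeff hF.1.pderiv v hδ).2] at hi
  have hge : 2 * δ ≤ (g i).natDegree :=
    (Nat.mul_le_mul_right δ (by omega)).trans (Polynomial.le_natDegree_of_ne_zero hi)
  have hgi : g i ≠ 0 := fun h => hi (by change (g i).coeff _ = 0; simp [h])
  have hlt : (lam * g i).natDegree < 2 * δ := by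
    fin_cases i
    · exact l0 ▸ hsub 1 2
    · exact l1 ▸ hsub 2 0
    · exact l2 ▸ hsub 0 1
  rw [Polynomial.natDegree_mul hlam0 hgi] at hlt
  omega

lemma aeval_mul_of_isHomogeneous {R S σ : Type*} [CommRing R] [CommRing S] [Algebra R S] [Fintype σ]
    {G : MvPolynomial σ R} {n : ℕ} (hG : G.IsHomogeneous n) (c : S) (v : σ → S) :
    aeval (fun i => c * v i) G = c ^ n * aeval v G := by
  rw [aeval_def, aeval_def, eval₂_eq', eval₂_eq', Finset.mul_sum]
  refine Finset.sum_congr rfl fun m hm => ?_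
  have := hG (mem_support_iff.mp hm)
  rw [Finsupp.weight_apply, Finsupp.sum_fintype _ _ (by simp)] at this
  simp only [Pi.one_apply, smul_eq_mul, mul_one] at this
  simp_rw [mul_pow, Finset.prod_mul_distrib, Finset.prod_pow_eq_pow_sum, this]
  ring

/-- A smooth plane curve of degree at least three has no rational section over the `x`-line. -/
lemma IsSmoothPlaneCurve.aeval_section_ne_zero [CharZero k] {d : ℕ} (hd : 3 ≤ d)
    {F : MvPolynomial (Fin 3) k} (hF : IsSmoothPlaneCurve d F) (s : k) {t : k} (ht : t ≠ 0)
    {l : k[X]} (hl : l ≠ 0) (q : k[X]) :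
    aeval ![l * (Polynomial.C s + Polynomial.C t * Polynomial.X), l, q] F ≠ 0 := by
  classical
  intro h
  obtain ⟨l', hl'⟩ := EuclideanDomain.gcd_dvd_left l q
  obtain ⟨q', hq'⟩ := EuclideanDomain.gcd_dvd_right l q
  have hbez := EuclideanDomain.gcd_eq_gcd_ab l q
  set g := EuclideanDomain.gcd l q
  set a := EuclideanDomain.gcdA l q
  set b := EuclideanDomain.gcdB l q
  have hg : g ≠ 0 := fun h => hl (by rw [hl', h, zero_mul])
  have hcop : IsCoprime l' q' := by
    refine ⟨a, b, mul_left_cancel₀ hg ?_⟩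
    linear_combination -hbez - a * hl' - b * hq'
  set x : k[X] := Polynomial.C s + Polynomial.C t * Polynomial.X
  have hvec : ![l * x, l, q] = fun i => g * ![l' * x, l', q'] i := by
    funext i
    fin_cases i
    · change l * x = g * (l' * x)
      rw [← mul_assoc, ← hl']
    · exact hl'
    · exact hq'
  rw [hvec, aeval_mul_of_isHomogeneous hF.1] at h
  have hw := hF.wronskian_eq_zero hd (v := ![l' * x, l', q']) hcop
    ((mul_eq_zero.mp h).resolve_left (pow_ne_zero _ hg))
  have hl0 : l' ≠ 0 := by
    rintro rfl
    exact hl (by rw [hl', mul_zero])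
  have : l' ^ 2 * Polynomial.C t = 0 := by
    simp [x] at hw
    linear_combination -hw
  simp [hl0, ht] at this

end PolynomialPoints

section Interpolation

/-- A finitary van der Waerden theorem. -/
lemma exists_mono_arithmetic_progression_le (κ : Type) [Finite κ] (M : ℕ) :
    ∃ W, ∀ c : ℕ → κ, ∃ a b, a ≤ W ∧ 0 < b ∧ b ≤ W ∧ ∀ s ≤ M, c (a + b * s) = c a := by
  classical
  obtain ⟨ι, _, hι⟩ := Combinatorics.Line.exists_mono_in_high_dimension (Fin (M + 1)) κ
  refine ⟨Fintype.card ι * (M + 1), fun c => ?_⟩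
  obtain ⟨l, γ, hl⟩ := hι fun v => c (∑ i, (v i : ℕ))
  let S : Finset ι := {i | l.idxFun i = none}
  let a : ℕ := ∑ i ∈ Sᶜ, (l 0 i : ℕ)
  have hline (x : Fin (M + 1)) : ∑ i, (l x i : ℕ) = a + S.card * x := by
    rw [← Finset.sum_add_sum_compl S, add_comm]
    congr 1
    · refine Finset.sum_congr rfl fun i hi => ?_
      have hi : l.idxFun i ≠ none := by simpa [S] using hi
      obtain ⟨y, hy⟩ := Option.ne_none_iff_exists'.mp hi
      rw [l.apply_some hy, l.apply_some hy]
    · rw [← smul_eq_mul, ← Finset.sum_const]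
      refine Finset.sum_congr rfl fun i hi => ?_
      rw [l.apply_none _ _ (by simpa [S] using hi)]
  have hcolor (s : ℕ) (hs : s ≤ M) : c (a + S.card * s) = γ := by
    exact (congrArg c (hline ⟨s, Nat.lt_succ_of_le hs⟩)).symm.trans (hl ⟨s, Nat.lt_succ_of_le hs⟩)
  refine ⟨a, S.card, ?_, Finset.card_pos.mpr ⟨l.proper.choose, ?_⟩, ?_, fun s hs => ?_⟩
  · calc a ≤ ∑ i ∈ Sᶜ, (M + 1) := Finset.sum_le_sum fun i _ => (l 0 i).2.le
      _ ≤ _ := by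
        rw [Finset.sum_const, smul_eq_mul]
        exact Nat.mul_le_mul_right _ (Finset.card_le_univ _)
  · simpa [S] using l.proper.choose_spec
  · exact (Finset.card_le_univ _).trans (Nat.le_mul_of_pos_right _ M.succ_pos)
  · have h0 := hcolor 0 M.zero_le
    rw [mul_zero, add_zero] at h0
    rw [hcolor s hs, h0]

variable {A : Type*} [CommRing A]

lemma exists_fwdDiff_iter_eval_mul_eq (π : A) (m : ℕ) (ψ : A[X]) :
    ∃ χ : A[X], ∀ r : ℕ, (fwdDiff 1)^[m] (fun s : ℕ => ψ.eval (π * s)) r =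
      π ^ m * χ.eval (π * r) := by
  induction m with
  | zero => exact ⟨ψ, fun r => by simp⟩
  | succ m ih =>
    obtain ⟨χ, hχ⟩ := ih
    obtain ⟨θ, hθ⟩ := Polynomial.sub_dvd_eval_sub (Polynomial.X + Polynomial.C π) Polynomial.X
      (χ.map Polynomial.C)
    refine ⟨θ, fun r => ?_⟩
    have hθr := congrArg (Polynomial.eval (π * r)) hθ
    simp only [Polynomial.eval_map, add_sub_cancel_left, Polynomial.eval_mul, Polynomial.eval_C,
      Polynomial.eval_sub] at hθr
    rw [← Polynomial.comp, ← Polynomial.comp, Polynomial.eval_comp, Polynomial.eval_comp] at hθr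
    rw [Function.iterate_succ_apply', fwdDiff, hχ, hχ, ← mul_sub, pow_succ, mul_assoc, ← hθr]
    simp [mul_add]

lemma fwdDiff_iter_sub_mem {I : Ideal A} {f g : ℕ → A} {m r : ℕ}
    (h : ∀ i ≤ m, f (r + i) - g (r + i) ∈ I) : (fwdDiff 1)^[m] f r - (fwdDiff 1)^[m] g r ∈ I := by
  rw [fwdDiff_iter_eq_sum_shift, fwdDiff_iter_eq_sum_shift, ← Finset.sum_sub_distrib]
  refine I.sum_mem fun i hi => ?_
  rw [← smul_sub, smul_eq_mul, mul_one]
  exact zsmul_mem (h i (Nat.lt_succ_iff.mp (Finset.mem_range.mp hi))) _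

lemma fwdDiff_iter_add_eq_zero {Y : ℕ → A} {m M : ℕ}
    (hY : ∀ s, s + m ≤ M → (fwdDiff 1)^[m] Y s = 0) (i s : ℕ) (h : s + m + i ≤ M) :
    (fwdDiff 1)^[m + i] Y s = 0 := by
  induction i generalizing s with
  | zero => exact hY s h
  | succ i ih =>
    rw [← add_assoc, Function.iterate_succ_apply', fwdDiff, ih s (by omega),
      ih (s + 1) (by omega), sub_zero]

lemma exists_polynomial_eval_eq_of_fwdDiff_iter_eq_zero (K : Type*) [Field K] [CharZero K]
    [Algebra A K] {Y : ℕ → A} {m M : ℕ} (hY : ∀ s, s + m ≤ M → (fwdDiff 1)^[m] Y s = 0) :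
    ∃ Q : K[X], Q.natDegree ≤ m ∧ ∀ s ≤ M, Q.eval (s : K) = algebraMap A K (Y s) := by
  refine ⟨∑ j ∈ Finset.range m,
    Polynomial.C (algebraMap A K ((fwdDiff 1)^[j] Y 0) / j.factorial) * descPochhammer K j,
    Polynomial.natDegree_sum_le_of_forall_le _ _ fun j hj =>
      (Polynomial.natDegree_C_mul_le _ _).trans ?_, fun s hs => ?_⟩
  · rw [descPochhammer_natDegree]
    exact (Finset.mem_range.mp hj).le
  · have hshift := shift_eq_sum_fwdDiff_iter 1 Y s 0
    rw [zero_add, smul_eq_mul, mul_one] at hshift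
    have hterm (j : ℕ) : (Polynomial.C (algebraMap A K ((fwdDiff 1)^[j] Y 0) / j.factorial) *
        descPochhammer K j).eval (s : K) = algebraMap A K (s.choose j • (fwdDiff 1)^[j] Y 0) := by
      rw [Polynomial.eval_mul, Polynomial.eval_C, descPochhammer_eval_eq_descFactorial,
        Nat.descFactorial_eq_factorial_mul_choose, nsmul_eq_mul, map_mul, map_natCast]
      have : (j.factorial : K) ≠ 0 := Nat.cast_ne_zero.mpr j.factorial_ne_zero
      push_cast
      field_simp
    rw [hshift, map_sum, Polynomial.eval_finsetSum, Finset.sum_congr rfl fun j _ => hterm j]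
    have hzero (j : ℕ) (hj : j ∉ Finset.range m ∩ Finset.range (s + 1))
        (hj' : j ∈ Finset.range m ∪ Finset.range (s + 1)) :
        algebraMap A K (s.choose j • (fwdDiff 1)^[j] Y 0) = 0 := by
      simp only [Finset.mem_inter, Finset.mem_union, Finset.mem_range] at hj hj'
      rcases lt_or_ge s j with h | h
      · simp [Nat.choose_eq_zero_of_lt h]
      · obtain ⟨i, rfl⟩ : ∃ i, j = m + i := ⟨j - m, by omega⟩
        rw [fwdDiff_iter_add_eq_zero hY i 0 (by omega), smul_zero, map_zero]
    rw [← Finset.sum_subset Finset.inter_subset_left fun j hj hj' =>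
        hzero j hj' (Finset.mem_union_left _ hj),
      ← Finset.sum_subset Finset.inter_subset_right fun j hj hj' =>
        hzero j hj' (Finset.mem_union_right _ hj)]

end Interpolation

section Hensel

open Polynomial in
lemma Polynomial.evalEval_sub_evalEval_mem {A : Type*} [CommRing A] {I : Ideal A} (h : A[X][X])
    {x x' y y' : A} (hx : x - x' ∈ I) (hy : y - y' ∈ I) :
    h.evalEval x y - h.evalEval x' y' ∈ I := by
  rw [← Ideal.Quotient.eq] at hx hy ⊢
  rw [← map_mapRingHom_evalEval, ← map_mapRingHom_evalEval, hx, hy]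

/-- Near a simple zero modulo `I`, the zeros of `h` are interpolated `I`-adically by a
polynomial. -/
lemma exists_eval_sub_mem_pow_of_evalEval_eq_zero {A : Type*} [CommRing A] (I : Ideal A)
    (h : A[X][X]) (x₀ y₀ u : A)
    (hu : (Polynomial.derivative h).evalEval x₀ y₀ * u - 1 ∈ I) (m : ℕ) :
    ∃ ψ : A[X], ∀ x ∈ I, ∀ y, y - y₀ ∈ I → h.evalEval (x₀ + x) y = 0 →
      y - ψ.eval x ∈ I ^ (m + 1) := by
  induction m with
  | zero => exact ⟨Polynomial.C y₀, fun x _ y hy _ => by simpa using hy⟩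
  | succ m ih =>
    obtain ⟨ψ, hψ⟩ := ih
    let Φ := Polynomial.eval₂RingHom
      (Polynomial.compRingHom (Polynomial.C x₀ + Polynomial.X : A[X])) ψ
    have hΦ (x : A) : (Φ h).eval x = h.evalEval (x₀ + x) (ψ.eval x) := by
      have : (Polynomial.evalRingHom x).comp Φ =
          Polynomial.evalEvalRingHom (x₀ + x) (ψ.eval x) := by
        apply Polynomial.ringHom_ext'
        · apply Polynomial.ringHom_ext' <;> [ext; skip] <;> simp [Φ]
        · simp [Φ]
      exact congrArg (fun f => f h) this
    refine ⟨ψ - Polynomial.C u * Φ h, fun x hx y hy hzero => ?_⟩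
    have he := hψ x hx y hy hzero
    set z := ψ.eval x
    set g := h.map (Polynomial.evalRingHom (x₀ + x))
    have hgy : g.eval y = 0 := by rwa [Polynomial.map_evalRingHom_eval]
    obtain ⟨c, hc⟩ := Polynomial.binomExpansion g z (y - z)
    rw [add_sub_cancel, hgy] at hc
    have hz : z - y₀ ∈ I := by
      rw [← sub_sub_sub_cancel_left]
      exact I.sub_mem hy (Ideal.pow_le_self m.succ_ne_zero he)
    have hder : 1 - g.derivative.eval z * u ∈ I := by
      rw [Polynomial.derivative_map, Polynomial.map_evalRingHom_eval]
      have hx₀ : x₀ + x - x₀ ∈ I := by rwa [add_sub_cancel_left]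
      have := I.add_mem hu (I.mul_mem_right u
        (Polynomial.evalEval_sub_evalEval_mem (Polynomial.derivative h) hx₀ hz))
      rw [← neg_mem_iff]
      convert this using 1
      ring
    have hgz : g.eval z = h.evalEval (x₀ + x) z := Polynomial.map_evalRingHom_eval _ _ _
    rw [Polynomial.eval_sub, Polynomial.eval_mul, Polynomial.eval_C, hΦ, ← hgz]
    have hsq : (y - z) ^ 2 ∈ I ^ (m + 1 + 1) := by
      have := Ideal.pow_mem_pow he 2
      rw [← pow_mul] at this
      exact Ideal.pow_le_pow_right (by omega) this
    have hlin : (y - z) * (1 - g.derivative.eval z * u) ∈ I ^ (m + 1 + 1) := by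
      rw [pow_succ]
      exact Ideal.mul_mem_mul he hder
    convert Ideal.sub_mem _ hlin ((I ^ (m + 1 + 1)).mul_mem_left (u * c) hsq) using 1
    linear_combination (-u) * hc

end Hensel

section Size

open NumberField

variable {k : Type} [Field k] [NumberField k]

lemma dvd_absNorm_of_natCast_mem {P : Ideal (𝓞 k)} (hP : P ≠ ⊤) {p : ℕ}
    (hp : p.Prime) (hpP : (p : 𝓞 k) ∈ P) : p ∣ Ideal.absNorm P := by
  by_contra hnd
  obtain ⟨x, y, hxy⟩ := Nat.Coprime.isCoprime ((hp.coprime_iff_not_dvd).mpr hnd)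
  refine hP ((Ideal.eq_top_iff_one P).mpr ?_)
  have := congrArg (fun z : ℤ => (z : 𝓞 k)) hxy
  push_cast at this
  rw [← this]
  exact P.add_mem (P.mul_mem_left _ hpP) (P.mul_mem_left _ (Ideal.absNorm_mem P))

lemma eq_zero_of_mem_pow_of_house_pow_lt {P : Ideal (𝓞 k)} (hP : P ≠ ⊤) {p : ℕ}
    (hp : p.Prime) (hpP : (p : 𝓞 k) ∈ P) {m : ℕ} {a : 𝓞 k} (ha : a ∈ P ^ m)
    (hsize : house (a : k) ^ Module.finrank ℚ k < (p : ℝ) ^ m) : a = 0 := by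
  by_contra h0
  have hpd := dvd_absNorm_of_natCast_mem hP hp hpP
  have hdvd : p ^ m ∣ (Algebra.norm ℤ a).natAbs := by
    rw [← Ideal.absNorm_span_singleton]
    refine (pow_dvd_pow_of_dvd hpd m).trans ?_
    rw [← map_pow]
    exact Ideal.absNorm_dvd_absNorm_of_le ((Ideal.span_singleton_le_iff_mem _).mpr ha)
  have hle : p ^ m ≤ (Algebra.norm ℤ a).natAbs :=
    Nat.le_of_dvd (Int.natAbs_pos.mpr (Algebra.norm_ne_zero_iff.mpr h0)) hdvd
  obtain ⟨σ⟩ : Nonempty (k →+* ℂ) := inferInstance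
  have hnorm := norm_norm_le_norm_mul_house_pow (a : k) σ
  have hr : Module.finrank ℚ k = Module.finrank ℚ k - 1 + 1 :=
    (Nat.sub_add_cancel Module.finrank_pos).symm
  have hbound : ‖Algebra.norm ℚ (a : k)‖ ≤ house (a : k) ^ Module.finrank ℚ k := by
    refine hnorm.trans ?_
    conv_rhs => rw [hr, pow_succ']
    exact mul_le_mul_of_nonneg_right (norm_embedding_le_house _ σ)
      (pow_nonneg (house_nonneg _) _)
  rw [← Algebra.coe_norm_int, Int.norm_cast_rat, Int.norm_eq_abs] at hbound
  have : (p : ℝ) ^ m ≤ ((Algebra.norm ℤ a).natAbs : ℝ) := by exact_mod_cast hle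
  rw [Nat.cast_natAbs, Int.cast_abs] at this
  linarith

lemma house_eval_natCast_le (c : (𝓞 k)[X]) :
    ∃ B : ℝ, 0 ≤ B ∧ ∀ n : ℕ,
      house ((c.eval (n : 𝓞 k) : 𝓞 k) : k) ≤ B * ((n : ℝ) + 1) ^ c.natDegree := by
  refine ⟨∑ i ∈ Finset.range (c.natDegree + 1), house (c.coeff i : k),
    Finset.sum_nonneg fun i _ => house_nonneg _, fun n => ?_⟩
  change house (algebraMap (𝓞 k) k _) ≤ _
  rw [Polynomial.eval_eq_sum_range, map_sum, Finset.sum_mul]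
  refine (house_sum_le_sum_house _ _).trans (Finset.sum_le_sum fun i hi => ?_)
  rw [map_mul, map_pow, map_natCast]
  refine (house_mul_le _ _).trans (mul_le_mul_of_nonneg_left ?_ (house_nonneg _))
  have hn : house (n : k) = n := by simpa using house_intCast (K := k) (n : ℤ)
  refine (house_pow_le _ _).trans ?_
  rw [hn]
  calc (n : ℝ) ^ i ≤ ((n : ℝ) + 1) ^ i := by gcongr; linarith
    _ ≤ _ := pow_le_pow_right₀ (by linarith [n.cast_nonneg (α := ℝ)])
      (Nat.lt_succ_iff.mp (Finset.mem_range.mp hi))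

/-- Integral zeros of a monic polynomial grow at most polynomially. -/
lemma exists_house_le_of_evalEval_eq_zero {h : (𝓞 k)[X][X]} (hh : h.Monic) :
    ∃ (B : ℝ) (E : ℕ), 0 ≤ B ∧ ∀ (n : ℕ) (y : 𝓞 k), h.evalEval (n : 𝓞 k) y = 0 →
      house (y : k) ≤ B * ((n : ℝ) + 1) ^ E := by
  choose B hB0 hB using fun i => house_eval_natCast_le (h.coeff i)
  let S := Finset.range (h.natDegree)
  let E := S.sup fun i => (h.coeff i).natDegree
  have hBS : 0 ≤ ∑ i ∈ S, B i := Finset.sum_nonneg fun i _ => hB0 i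
  refine ⟨∑ i ∈ S, B i + 1, E, by linarith, fun n y hy => ?_⟩
  have hn1 : 1 ≤ (n : ℝ) + 1 := by linarith [n.cast_nonneg (α := ℝ)]
  have hcoeff (i : ℕ) (hi : i ∈ S) :
      house (((h.coeff i).eval (n : 𝓞 k) : 𝓞 k) : k) ≤ (∑ i ∈ S, B i) * ((n : ℝ) + 1) ^ E :=
    (hB i n).trans <| mul_le_mul (Finset.single_le_sum (fun i _ => hB0 i) hi)
      (pow_le_pow_right₀ hn1 (Finset.le_sup (f := fun i => (h.coeff i).natDegree) hi))
      (by positivity) hBS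
  rw [house, pi_norm_le_iff_of_nonneg (by positivity)]
  intro σ
  change ‖σ y‖ ≤ _
  let f : (𝓞 k)[X] →+* ℂ :=
    (σ.comp (algebraMap (𝓞 k) k)).comp (Polynomial.evalRingHom (n : 𝓞 k))
  have hmonic : (h.map f).Monic := hh.map f
  have hroot : (h.map f).IsRoot (σ y) := by
    rw [Polynomial.IsRoot.def, ← Polynomial.map_map, Polynomial.eval_map]
    change Polynomial.eval₂ _ ((σ.comp (algebraMap (𝓞 k) k)) y) _ = 0
    rw [Polynomial.eval₂_hom, Polynomial.map_evalRingHom_eval, hy, map_zero]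
  refine (NNReal.coe_le_coe.mpr (hroot.norm_lt_cauchyBound hmonic.ne_zero).le).trans ?_
  rw [Polynomial.cauchyBound, hmonic.leadingCoeff, nnnorm_one, div_one, hh.natDegree_map]
  have hX' : 0 ≤ (∑ i ∈ S, B i) * ((n : ℝ) + 1) ^ E := by positivity
  have hsup : Finset.sup S (fun i => ‖(h.map f).coeff i‖₊) ≤
      Real.toNNReal ((∑ i ∈ S, B i) * ((n : ℝ) + 1) ^ E) := by
    refine Finset.sup_le fun i hi => ?_
    rw [Real.le_toNNReal_iff_coe_le hX', coe_nnnorm, Polynomial.coeff_map]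
    exact (norm_embedding_le_house _ σ).trans (hcoeff i hi)
  rw [Real.le_toNNReal_iff_coe_le hX'] at hsup
  rw [add_mul, one_mul, NNReal.coe_add, NNReal.coe_one]
  exact add_le_add hsup (one_le_pow₀ hn1)

end Size

section IntegralSequence

open NumberField

variable {k : Type} [Field k] [NumberField k]

lemma house_fwdDiff_iter_le {Y : ℕ → 𝓞 k} {H : ℝ} {m s : ℕ}
    (hY : ∀ i ≤ m, house (Y (s + i) : k) ≤ H) :
    house (((fwdDiff 1)^[m] Y s : 𝓞 k) : k) ≤ 2 ^ m * H := by
  induction m generalizing s with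
  | zero => simpa using hY 0 le_rfl
  | succ m ih =>
    rw [Function.iterate_succ_apply', fwdDiff, RingOfIntegers.coe_eq_algebraMap, map_sub, house,
      map_sub]
    refine (norm_sub_le _ _).trans ?_
    have h1 := ih (s := s + 1) fun i hi => by
      rw [add_assoc, add_comm 1 i]
      exact hY (i + 1) (by omega)
    have h2 := ih (s := s) fun i hi => hY i (by omega)
    rw [pow_succ, mul_two, add_mul]
    exact add_le_add h1 h2

/-- An integral sequence of zeros of a monic separable polynomial coincides with polynomials of
bounded degree at arbitrarily many places. -/
lemma exists_polynomial_eval_eq_of_monic {h a b : (𝓞 k)[X][X]} (hh : h.Monic) {D : (𝓞 k)[X]}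
    (hD : D ≠ 0) (hab : a * h + b * Polynomial.derivative h = Polynomial.C D) {y : ℕ → 𝓞 k}
    (hy : ∀ n : ℕ, h.evalEval (n : 𝓞 k) (y n) = 0) :
    ∃ m, ∀ M, ∃ q : k[X], q.natDegree ≤ m ∧
      ∃ S : Finset ℕ, M ≤ S.card ∧ ∀ n ∈ S, q.eval (n : k) = y n := by
  classical
  obtain ⟨n₀, hn₀⟩ : ∃ n : ℕ, D.eval (n : 𝓞 k) ≠ 0 := by
    by_contra! hall
    exact hD <| Polynomial.eq_zero_of_infinite_isRoot _ <|
      Set.infinite_of_injective_forall_mem Nat.cast_injective hall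
  obtain ⟨B, E, hB0, hB⟩ := exists_house_le_of_evalEval_eq_zero hh
  set r := Module.finrank ℚ k with hr
  have hrpos : 0 < r := Module.finrank_pos
  set m := E * r + 1 with hm
  refine ⟨m, fun M => ?_⟩
  obtain ⟨W, hW⟩ := exists_mono_arithmetic_progression_le (Fin (h.natDegree)) M
  let T := n₀ + 1 + W + W * M
  let K : ℝ := 2 ^ m * (B * (T : ℝ) ^ E)
  have hK : 0 ≤ K := by positivity
  obtain ⟨p, hple, hp⟩ := Nat.exists_infinite_primes
    (⌈K ^ r⌉₊ + Ideal.absNorm (Ideal.span {D.eval (n₀ : 𝓞 k)}) + 1)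
  have hKp : K ^ r < p := (Nat.le_ceil _).trans_lt (by exact_mod_cast (by omega))
  obtain ⟨P, hPmax, hpP⟩ : ∃ P : Ideal (𝓞 k), P.IsMaximal ∧ (p : 𝓞 k) ∈ P := by
    obtain ⟨P, hPmax, hle⟩ := Ideal.exists_le_maximal (Ideal.span {(p : 𝓞 k)}) fun htop => by
      rw [← Ideal.absNorm_eq_one_iff, Ideal.absNorm_span_natCast, RingOfIntegers.rank] at htop
      exact hp.one_lt.ne' ((Nat.pow_eq_one.mp htop).resolve_right hrpos.ne')
    exact ⟨P, hPmax, (Ideal.span_singleton_le_iff_mem _).mp hle⟩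
  have hDP : D.eval (n₀ : 𝓞 k) ∉ P := fun hmem => by
    have h1 := (dvd_absNorm_of_natCast_mem hPmax.ne_top hp hpP).trans
      (Ideal.absNorm_dvd_absNorm_of_le ((Ideal.span_singleton_le_iff_mem _).mpr hmem))
    have h2 : Ideal.absNorm (Ideal.span {D.eval (n₀ : 𝓞 k)}) ≠ 0 := by
      rw [Ne, Ideal.absNorm_eq_zero_iff, Ideal.span_singleton_eq_bot]
      exact hn₀
    have := Nat.le_of_dvd (Nat.pos_of_ne_zero h2) h1
    omega
  have hcongr (j : ℕ) : ((n₀ + p * j : ℕ) : 𝓞 k) - n₀ ∈ P := by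
    push_cast
    rw [add_sub_cancel_left]
    exact P.mul_mem_right _ hpP
  let _ := Ideal.Quotient.field P
  let g : (𝓞 k ⧸ P)[X] := (h.map (Polynomial.evalRingHom (n₀ : 𝓞 k))).map (Ideal.Quotient.mk P)
  have hg : g.Monic := (hh.map _).map _
  have hroot (j : ℕ) : Ideal.Quotient.mk P (y (n₀ + p * j)) ∈ g.roots.toFinset := by
    rw [Multiset.mem_toFinset, Polynomial.mem_roots hg.ne_zero, Polynomial.IsRoot.def,
      Polynomial.eval_map, Polynomial.eval₂_hom, Polynomial.map_evalRingHom_eval,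
      Ideal.Quotient.eq_zero_iff_mem, ← neg_mem_iff, ← zero_sub, ← hy (n₀ + p * j)]
    exact Polynomial.evalEval_sub_evalEval_mem h (hcongr j) (by simp)
  have hcard : Fintype.card g.roots.toFinset ≤ Fintype.card (Fin h.natDegree) := by
    rw [Fintype.card_coe, Fintype.card_fin]
    refine (Multiset.toFinset_card_le _).trans ((Polynomial.card_roots' g).trans_eq ?_)
    rw [(hh.map _).natDegree_map, hh.natDegree_map]
  obtain ⟨φ⟩ := Function.Embedding.nonempty_of_card_le hcard
  obtain ⟨c, e, hcW, he, heW, hmono⟩ := hW fun j => φ ⟨_, hroot j⟩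
  have hclass (s : ℕ) (hs : s ≤ M) : y (n₀ + p * (c + e * s)) - y (n₀ + p * c) ∈ P := by
    rw [← Ideal.Quotient.eq]
    exact congrArg Subtype.val (φ.injective (hmono s hs))
  set N := n₀ + p * c with hN
  have hDN : D.eval (N : 𝓞 k) ∉ P := fun hmem => hDP <| by
    have := P.sub_mem hmem (P.mem_of_dvd (Polynomial.sub_dvd_eval_sub _ _ D) (hcongr c))
    rwa [sub_sub_cancel] at this
  obtain ⟨u, i, hiP, hu⟩ := hPmax.exists_inv hDN
  have habN := congrArg (Polynomial.evalEval (N : 𝓞 k) (y N)) hab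
  rw [Polynomial.evalEval_add, Polynomial.evalEval_mul, Polynomial.evalEval_mul, hy, mul_zero,
    zero_add, Polynomial.evalEval_C] at habN
  obtain ⟨ψ, hψ⟩ := exists_eval_sub_mem_pow_of_evalEval_eq_zero P h N (y N)
    (b.evalEval (N : 𝓞 k) (y N) * u) (by
      rw [← mul_assoc, mul_comm (Polynomial.evalEval _ _ _), habN, mul_comm, ← hu,
        sub_add_cancel_left]
      exact P.neg_mem hiP) m
  let Y : ℕ → 𝓞 k := fun s => y (n₀ + p * (c + e * s))
  let π : 𝓞 k := p * e
  have hπ : π ∈ P := P.mul_mem_right _ hpP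
  have hYψ (s : ℕ) (hs : s ≤ M) : Y s - ψ.eval (π * s) ∈ P ^ m := by
    refine Ideal.pow_le_pow_right m.le_succ (hψ _ (P.mul_mem_right _ hπ) _ (hclass s hs) ?_)
    have harg : (N : 𝓞 k) + π * s = ((n₀ + p * (c + e * s) : ℕ) : 𝓞 k) := by
      simp only [hN, π]
      push_cast
      ring
    rw [harg]
    exact hy _
  have hYsize (s : ℕ) (hs : s ≤ M) : house (Y s : k) ≤ B * ((T : ℝ) * p) ^ E := by
    refine (hB _ _ (hy _)).trans (mul_le_mul_of_nonneg_left ?_ hB0)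
    gcongr
    have h1 : n₀ + p * (c + e * s) + 1 ≤ T * p := by
      have h2 : e * s ≤ W * M := Nat.mul_le_mul heW hs
      have h3 : p * (c + e * s) ≤ p * (W + W * M) := Nat.mul_le_mul_left _ (by omega)
      have h4 : n₀ + 1 ≤ (n₀ + 1) * p := Nat.le_mul_of_pos_right _ hp.pos
      calc n₀ + p * (c + e * s) + 1 ≤ (n₀ + 1) * p + p * (W + W * M) := by omega
        _ = T * p := by ring
    exact_mod_cast h1
  have hdiff (s : ℕ) (hs : s + m ≤ M) : (fwdDiff 1)^[m] Y s = 0 := by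
    refine eq_zero_of_mem_pow_of_house_pow_lt hPmax.ne_top hp hpP (m := m) ?_ ?_
    · obtain ⟨χ, hχ⟩ := exists_fwdDiff_iter_eval_mul_eq π m ψ
      have h1 := fwdDiff_iter_sub_mem (f := Y) (g := fun s : ℕ => ψ.eval (π * s)) (m := m)
        (r := s) fun i hi => hYψ (s + i) (by omega)
      rw [hχ] at h1
      exact (Submodule.sub_mem_iff_left _
        (Ideal.mul_mem_right _ _ (Ideal.pow_mem_pow hπ m))).mp h1
    · have h1 := house_fwdDiff_iter_le (Y := Y) (m := m) (s := s)
        fun i hi => hYsize (s + i) (by omega)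
      calc house (((fwdDiff 1)^[m] Y s : 𝓞 k) : k) ^ r
          ≤ (2 ^ m * (B * ((T : ℝ) * p) ^ E)) ^ r := pow_le_pow_left₀ (house_nonneg _) h1 r
        _ = K ^ r * (p : ℝ) ^ (E * r) := by
          rw [pow_mul, ← mul_pow]
          simp only [K]
          ring
        _ < p * (p : ℝ) ^ (E * r) :=
          mul_lt_mul_of_pos_right hKp (pow_pos (by exact_mod_cast hp.pos) _)
        _ = (p : ℝ) ^ m := by rw [hm, pow_succ']
  obtain ⟨Q, hQdeg, hQ⟩ := exists_polynomial_eval_eq_of_fwdDiff_iter_eq_zero k hdiff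
  have hπ0 : ((p * e : ℕ) : k) ≠ 0 := Nat.cast_ne_zero.mpr (mul_pos hp.pos he).ne'
  refine ⟨Q.comp (Polynomial.C ((p * e : ℕ) : k)⁻¹ * (Polynomial.X - Polynomial.C (N : k))), ?_,
    (Finset.range (M + 1)).image fun s => n₀ + p * (c + e * s), ?_, ?_⟩
  · rw [Polynomial.natDegree_comp, Polynomial.natDegree_C_mul (inv_ne_zero hπ0),
      Polynomial.natDegree_X_sub_C, mul_one]
    exact hQdeg
  · rw [Finset.card_image_of_injective, Finset.card_range]
    · exact M.le_succ
    · intro s s' hs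
      simpa [hp.ne_zero, he.ne'] using hs
  · intro n hn
    obtain ⟨s, hs, rfl⟩ := Finset.mem_image.mp hn
    have harg : (Polynomial.C ((p * e : ℕ) : k)⁻¹ *
        (Polynomial.X - Polynomial.C (N : k))).eval ((n₀ + p * (c + e * s) : ℕ) : k) = (s : k) := by
      simp only [Polynomial.eval_mul, Polynomial.eval_C, Polynomial.eval_sub, Polynomial.eval_X]
      rw [inv_mul_eq_iff_eq_mul₀ hπ0, hN]
      push_cast
      ring
    rw [Polynomial.eval_comp, harg]
    exact hQ s (Nat.lt_succ_iff.mp (Finset.mem_range.mp hs))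

end IntegralSequence

section MonicSeparable

lemma Polynomial.exists_mul_add_mul_eq_C_of_isCoprime_map {R : Type*} [CommRing R] [IsDomain R]
    (K : Type*) [Field K] [Algebra R K] [IsFractionRing R K] {f g : R[X]} (hf : f.natDegree ≠ 0)
    (hfg : IsCoprime (f.map (algebraMap R K)) (g.map (algebraMap R K))) :
    ∃ a b : R[X], ∃ D : R, D ≠ 0 ∧ a * f + b * g = Polynomial.C D := by
  have hinj := IsFractionRing.injective R K
  obtain ⟨a, b, -, -, hab⟩ :=
    Polynomial.exists_mul_add_mul_eq_C_resultant f g le_rfl le_rfl (Or.inl hf)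
  refine ⟨a, b, _, fun h0 => Polynomial.resultant_ne_zero _ _ hfg ?_, by rw [← hab]; ring⟩
  rw [Polynomial.natDegree_map_eq_of_injective hinj, Polynomial.natDegree_map_eq_of_injective hinj,
    Polynomial.resultant_map_map, h0, map_zero]

/-- A monic polynomial over an integrally closed domain has the same zeros as a monic polynomial
which is separable over the fraction field. -/
lemma Polynomial.Monic.exists_separable_dvd_pow {R : Type*} [CommRing R] [IsDomain R]
    [IsIntegrallyClosed R] [CharZero R] {g : R[X]} (hg : g.Monic) :
    ∃ h a b : R[X], ∃ (D : R) (N : ℕ), h.Monic ∧ D ≠ 0 ∧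
      a * h + b * Polynomial.derivative h = Polynomial.C D ∧ g ∣ h ^ N := by
  let K := FractionRing R
  have : CharZero K := IsFractionRing.charZero_of_isFractionRing R
  have hinj := IsFractionRing.injective R K
  obtain ⟨r, N, hsq, hrg, hgr⟩ :=
    exists_squarefree_dvd_pow_of_ne_zero (hg.map (algebraMap R K)).ne_zero
  obtain ⟨h, hh⟩ := IsIntegrallyClosed.eq_map_mul_C_of_dvd K hg hrg
  have hr0 : r.leadingCoeff ≠ 0 := Polynomial.leadingCoeff_ne_zero.mpr hsq.ne_zero
  have hassoc : Associated (h.map (algebraMap R K)) r := by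
    conv_rhs => rw [← hh]
    exact associated_mul_unit_right _ _ (Polynomial.isUnit_C.mpr hr0.isUnit)
  have hmonic : h.Monic := by
    refine Polynomial.monic_of_injective hinj ?_
    have := congrArg Polynomial.leadingCoeff hh
    rw [Polynomial.leadingCoeff_mul, Polynomial.leadingCoeff_C] at this
    exact (mul_eq_right₀ hr0).mp this
  have hdvd : g ∣ h ^ N := by
    rw [← Polynomial.map_dvd_map _ hinj hg, Polynomial.map_pow]
    exact hgr.trans (hassoc.pow_pow (n := N)).dvd'
  have hsep : (h.map (algebraMap R K)).Separable :=
    PerfectField.separable_iff_squarefree.mpr (hassoc.squarefree_iff.mpr hsq)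
  by_cases hdeg : h.natDegree = 0
  · rw [hmonic.natDegree_eq_zero] at hdeg
    subst hdeg
    exact ⟨1, 1, 0, 1, N, Polynomial.monic_one, one_ne_zero, by simp, hdvd⟩
  · rw [Polynomial.Separable, Polynomial.derivative_map] at hsep
    obtain ⟨a, b, D, hD, hab⟩ :=
      Polynomial.exists_mul_add_mul_eq_C_of_isCoprime_map K hdeg hsep
    exact ⟨h, a, b, D, N, hmonic, hD, hab, hdvd⟩

open NumberField

variable {k : Type} [Field k] [NumberField k]

/-- An algebraic sequence of elements of `k` agrees, up to multiplication by a fixed polynomial,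
with polynomials of bounded degree at arbitrarily many places. -/
lemma exists_polynomial_eval_eq_eval_mul {g : (𝓞 k)[X][X]} (hg : g ≠ 0) {z : ℕ → k}
    (hz : ∀ n : ℕ, g.eval₂ ((algebraMap (𝓞 k) k).comp (Polynomial.evalRingHom (n : 𝓞 k))) (z n)
      = 0) :
    ∃ l : k[X], l ≠ 0 ∧ ∃ m, ∀ M, ∃ q : k[X], q.natDegree ≤ m ∧
      ∃ S : Finset ℕ, M ≤ S.card ∧ ∀ n ∈ S, q.eval (n : k) = l.eval (n : k) * z n := by
  let φ (n : ℕ) : (𝓞 k)[X] →+* k :=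
    (algebraMap (𝓞 k) k).comp (Polynomial.evalRingHom (n : 𝓞 k))
  have hinj := FaithfulSMul.algebraMap_injective (𝓞 k) k
  have hdeg : 1 ≤ g.natDegree := by
    by_contra! hlt
    rw [Nat.lt_one_iff] at hlt
    rw [Polynomial.eq_C_of_natDegree_eq_zero hlt] at hg hz
    refine hg (Polynomial.C_eq_zero.mpr <| Polynomial.eq_zero_of_infinite_isRoot _ <|
      Set.infinite_of_injective_forall_mem (Nat.cast_injective (R := 𝓞 k)) fun n => hinj ?_)
    simpa using hz n
  have hg₀ := Polynomial.monic_integralNormalization hg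
  have hzero (n : ℕ) :
      g.integralNormalization.eval₂ (φ n) (φ n g.leadingCoeff * z n) = 0 := by
    rw [Polynomial.integralNormalization_eval₂_leadingCoeff_mul hdeg, hz n, mul_zero]
  have hint (n : ℕ) : ∃ y : 𝓞 k, algebraMap (𝓞 k) k y = φ n g.leadingCoeff * z n := by
    rw [← IsIntegrallyClosed.isIntegral_iff]
    refine ⟨g.integralNormalization.map (Polynomial.evalRingHom (n : 𝓞 k)), hg₀.map _, ?_⟩
    rw [Polynomial.eval₂_map]
    exact hzero n
  choose y hy using hint
  obtain ⟨h, a, b, D, N, hh, hD, hab, c, hc⟩ := hg₀.exists_separable_dvd_pow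
  have hroot (n : ℕ) : h.evalEval (n : 𝓞 k) (y n) = 0 := by
    refine hinj ?_
    rw [map_zero, ← Polynomial.map_evalRingHom_eval, ← Polynomial.eval₂_hom, Polynomial.eval₂_map,
      hy]
    refine eq_zero_of_pow_eq_zero (n := N) ?_
    rw [← Polynomial.eval₂_pow, hc, Polynomial.eval₂_mul]
    exact mul_eq_zero_of_left (hzero n) _
  obtain ⟨m, hm⟩ := exists_polynomial_eval_eq_of_monic hh hD hab hroot
  refine ⟨g.leadingCoeff.map (algebraMap (𝓞 k) k), ?_, m, fun M => ?_⟩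
  · rwa [Ne, Polynomial.map_eq_zero_iff hinj, Polynomial.leadingCoeff_eq_zero]
  · obtain ⟨q, hq, S, hS, hqS⟩ := hm M
    refine ⟨q, hq, S, hS, fun n hn => ?_⟩
    rw [hqS n hn, RingOfIntegers.coe_eq_algebraMap, hy, ← map_natCast (algebraMap (𝓞 k) k) n,
      Polynomial.eval_map_apply]
    rfl

end MonicSeparable

section Curve

variable {k : Type} [Field k]

lemma Polynomial.exists_ne_zero_eval₂_eq_zero_of_isFractionRing {R K : Type*} [CommRing R]
    [IsDomain R] [Field K] [Algebra R K] [IsFractionRing R K] {G : K[X][X]} (hG : G ≠ 0) :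
    ∃ g : R[X][X], g ≠ 0 ∧ ∀ (r : R) (z : K),
      G.eval₂ (Polynomial.evalRingHom (algebraMap R K r)) z = 0 →
        g.eval₂ ((algebraMap R K).comp (Polynomial.evalRingHom r)) z = 0 := by
  let _ : Algebra R[X] K[X] := Polynomial.algebra R K
  let M := Submonoid.map Polynomial.C (nonZeroDivisors R)
  have : IsLocalization M K[X] := Polynomial.isLocalization (nonZeroDivisors R) K
  have hM : M ≤ nonZeroDivisors R[X] := by
    rintro _ ⟨r, hr, rfl⟩
    exact mem_nonZeroDivisors_of_ne_zero
      (Polynomial.C_ne_zero.mpr (nonZeroDivisors.ne_zero hr))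
  refine ⟨IsLocalization.integerNormalization M G,
    mt (IsLocalization.integerNormalization_eq_zero_iff hM G).mp hG, fun r z h => ?_⟩
  have := IsLocalization.integerNormalization_eval₂_eq_zero M _ _ h
  have hcomp : (Polynomial.evalRingHom (algebraMap R K r)).comp (algebraMap R[X] K[X]) =
      (algebraMap R K).comp (Polynomial.evalRingHom r) := by
    ext x
    · simp
    · simp
  rwa [hcomp] at this

/-- The substitution of a point with coordinates in `k[X][X]` evaluates coordinatewise. -/
lemma eval₂_evalRingHom_aeval {σ : Type*} (F : MvPolynomial σ k) (v : σ → k[X][X]) (x z : k) :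
    (aeval v F).eval₂ (Polynomial.evalRingHom x) z =
      eval (fun i => (v i).eval₂ (Polynomial.evalRingHom x) z) F := by
  induction F using MvPolynomial.induction_on with
  | C a => simp [Polynomial.algebraMap_apply]
  | add p q hp hq => simp [hp, hq]
  | mul_X p i hp => simp [Polynomial.eval₂_mul, hp]

lemma IsSmoothPlaneCurve.dehomogenization_ne_zero [CharZero k] {d : ℕ}
    {F : MvPolynomial (Fin 3) k} (hF : IsSmoothPlaneCurve d F) (s : k) {t : k} (ht : t ≠ 0) :
    aeval ![Polynomial.C (Polynomial.C s + Polynomial.C t * Polynomial.X), 1,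
      (Polynomial.X : k[X][X])] F ≠ 0 := by
  intro h
  have hF0 : F ≠ 0 := by
    rintro rfl
    obtain ⟨i, hi⟩ := hF.exists_eval_pderiv_ne_zero (p := 1) one_ne_zero
    simp at hi
  have haff (x z : k) : eval ![s + t * x, 1, z] F = 0 := by
    have := eval₂_evalRingHom_aeval F
      ![Polynomial.C (Polynomial.C s + Polynomial.C t * Polynomial.X), 1, Polynomial.X] x z
    rw [h, Polynomial.eval₂_zero] at this
    rw [this]
    congr 2
    funext i
    fin_cases i <;> simp
  refine mul_ne_zero (X_ne_zero (1 : Fin 3)) hF0 (MvPolynomial.funext fun p => ?_)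
  rw [map_mul, eval_X, map_zero, mul_eq_zero, or_iff_not_imp_left]
  intro hp
  have := aeval_mul_of_isHomogeneous hF.1 (p 1) ![s + t * ((p 0 / p 1 - s) / t), 1, p 2 / p 1]
  rw [aeval_eq_eval, aeval_eq_eval, haff, mul_zero] at this
  rw [← this]
  congr 2
  funext i
  fin_cases i
  · simp
    field_simp
    ring
  · simp
  · simp
    field_simp

end Curve

/-- **Rational arithmetic progressions on smooth plane curves are finite.**
Let `C : F(X,Y,Z) = 0` be a smooth projective plane curve of degree `d ≥ 3` over a number
field `k` (so of genus `g ≥ 1`).  Then there is no infinite rational arithmetic progression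
sequence on `C`: there is no infinite sequence of pairwise distinct `k`-rational points
`P i = (x i : 1 : z i)` on `C` (normalized affinely at `Y = 1`, all coordinates in `k`)
whose `x`-coordinates form an arithmetic progression `x i = t' + (i+1) * t` with `t, t' ∈ k*`. -/
theorem rational_arithmetic_progression_on_smooth_plane_curve_is_finite
    (k : Type) [Field k] [NumberField k]
    (d : ℕ) (hd : 3 ≤ d)
    (F : MvPolynomial (Fin 3) k) (hF : IsSmoothPlaneCurve d F)
    (t t' : k) (ht : t ≠ 0) (ht' : t' ≠ 0)
    (P : ℕ → Fin 3 → k) (hinj : Function.Injective P)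
    (honC : ∀ i, eval (P i) F = 0)
    (hx : ∀ i, P i 0 = t' + (i + 1 : ℕ) * t)
    (hy : ∀ i, P i 1 = 1) :
    False := by
  let s := t' + t
  have hP (n : ℕ) : P n = ![s + t * n, 1, P n 2] := by
    funext i
    fin_cases i
    · simp [hx, s]
      ring
    · simp [hy]
    · simp
  obtain ⟨g, hg, hgz⟩ := Polynomial.exists_ne_zero_eval₂_eq_zero_of_isFractionRing
    (R := NumberField.RingOfIntegers k) (hF.dehomogenization_ne_zero s ht)
  obtain ⟨l, hl, m, hm⟩ := exists_polynomial_eval_eq_eval_mul hg (z := fun n => P n 2) fun n => by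
    refine hgz n _ ?_
    rw [eval₂_evalRingHom_aeval, ← honC n]
    congr 2
    rw [hP n]
    funext i
    fin_cases i <;> simp
  obtain ⟨q, hq, S, hS, hqS⟩ := hm (d * max (l.natDegree + 1) m + 1)
  refine hF.aeval_section_ne_zero hd s ht hl q ?_
  refine Polynomial.eq_zero_of_natDegree_lt_card_of_eval_eq_zero' _ (S.map Nat.castEmbedding) ?_ ?_
  · intro x hxS
    obtain ⟨n, hn, rfl⟩ := Finset.mem_map.mp hxS
    have := aeval_mul_of_isHomogeneous hF.1 (l.eval (n : k)) (P n)
    rw [aeval_eq_eval, aeval_eq_eval, honC, mul_zero] at this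
    rw [← this, Nat.castEmbedding_apply, ← Polynomial.coe_aeval_eq_eval, comp_aeval_apply,
      aeval_eq_eval]
    congr 2
    rw [hP n]
    funext i
    fin_cases i
    · simp
    · simp
    · simp [hqS n hn]
  · rw [Finset.card_map]
    refine (natDegree_aeval_le_and_coeff hF.1 _ (δ := max (l.natDegree + 1) m) ?_).1.trans_lt
      (by omega)
    intro i
    fin_cases i
    · refine le_max_of_le_left (Polynomial.natDegree_mul_le_of_le le_rfl ?_)
      compute_degree
    · exact le_max_of_le_left (Nat.le_succ _)
    · exact le_max_of_le_right hq
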